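/- Uniqueness under two-sided blow-up rate (power case): Let p > 1 and β := 2p/(p−1). Suppose u₁, u₂ ∈ C²(Ω) both satisfy Lu_i(x) = (u_i(x))₊^p for all x ∈ Ω and u_i(x) → +∞ as d(x) → 0 (i = 1, 2), and suppose there are constants N₁, N₂, ρ > 0 such that N₁ d(x)^{−β} ≤ (u_i(x))₊^p ≤ N₂ d(x)^{−β} for all x in Δ_ρ := {x ∈ Ω : d(x) < ρ} and i = 1, 2. Then u₁ ≡ u₂ in Ω. -/

import Mathlib

open Metric Set Filter Real Bornology

/-- First-order partial derivative `D_i u (x)`. -/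
noncomputable def pd {n : ℕ} (u : EuclideanSpace ℝ (Fin n) → ℝ) (i : Fin n)
    (x : EuclideanSpace ℝ (Fin n)) : ℝ :=
  fderiv ℝ u x (EuclideanSpace.single i 1)

/-- Second-order partial derivative `D_{ij} u (x)`. -/
noncomputable def pd2 {n : ℕ} (u : EuclideanSpace ℝ (Fin n) → ℝ) (i j : Fin n)
    (x : EuclideanSpace ℝ (Fin n)) : ℝ :=
  fderiv ℝ (fun y => fderiv ℝ u y (EuclideanSpace.single j 1)) x (EuclideanSpace.single i 1)

/-- The operator `L u = a^{ij} D_{ij} u + b^i D_i u - c u`. -/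
noncomputable def Lop {n : ℕ} (a : EuclideanSpace ℝ (Fin n) → Fin n → Fin n → ℝ)
    (b : EuclideanSpace ℝ (Fin n) → Fin n → ℝ) (c : EuclideanSpace ℝ (Fin n) → ℝ)
    (u : EuclideanSpace ℝ (Fin n) → ℝ) (x : EuclideanSpace ℝ (Fin n)) : ℝ :=
  (∑ i, ∑ j, a x i j * pd2 u i j x) + (∑ i, b x i * pd u i x) - c x * u x

/-- The standing assumptions on the coefficients of `L`: measurability, symmetry,
`Σ (b^i)² ≤ K`, `0 ≤ c ≤ K`, `K > 0`, and uniform ellipticity `λ|ξ|² ≤ aᵢⱼξᵢξⱼ ≤ Λ|ξ|²`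
with `0 < λ ≤ Λ`. -/
def CoeffsOK {n : ℕ} (a : EuclideanSpace ℝ (Fin n) → Fin n → Fin n → ℝ)
    (b : EuclideanSpace ℝ (Fin n) → Fin n → ℝ) (c : EuclideanSpace ℝ (Fin n) → ℝ)
    (K lam Lam : ℝ) : Prop :=
  (∀ i j, Measurable fun x => a x i j) ∧ (∀ i, Measurable fun x => b x i) ∧
  Measurable c ∧ (∀ x i j, a x i j = a x j i) ∧
  (∀ x, ∑ i, (b x i) ^ 2 ≤ K) ∧ (∀ x, 0 ≤ c x ∧ c x ≤ K) ∧
  0 < K ∧ 0 < lam ∧ lam ≤ Lam ∧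
  (∀ x (ξ : EuclideanSpace ℝ (Fin n)),
    lam * ‖ξ‖ ^ 2 ≤ ∑ i, ∑ j, a x i j * ξ i * ξ j ∧
    ∑ i, ∑ j, a x i j * ξ i * ξ j ≤ Lam * ‖ξ‖ ^ 2)

/-- `u(x) → +∞` as `d(x) := dist(x, ∂Ω) → 0`. -/
def BlowsUp {n : ℕ} (Ω : Set (EuclideanSpace ℝ (Fin n)))
    (u : EuclideanSpace ℝ (Fin n) → ℝ) : Prop :=
  ∀ M : ℝ, ∃ δ > 0, ∀ x ∈ Ω, infDist x (frontier Ω) < δ → M ≤ u x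

section helpers
open Topology
variable {n : ℕ}

lemma cd_fderiv {u : EuclideanSpace ℝ (Fin n) → ℝ} {x : EuclideanSpace ℝ (Fin n)}
    (hu : ContDiffAt ℝ 2 u x) : DifferentiableAt ℝ (fderiv ℝ u) x :=
  (hu.fderiv_right (m := 1) (by norm_num)).differentiableAt (by norm_num)

lemma cd_ev {u : EuclideanSpace ℝ (Fin n) → ℝ} {x : EuclideanSpace ℝ (Fin n)}
    (hu : ContDiffAt ℝ 2 u x) : ∀ᶠ y in 𝓝 x, DifferentiableAt ℝ u y := by
  filter_upwards [hu.eventually (by simp)] with y hy using hy.differentiableAt (by norm_num)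

lemma pd2_eq {u : EuclideanSpace ℝ (Fin n) → ℝ} {x : EuclideanSpace ℝ (Fin n)}
    (hu : ContDiffAt ℝ 2 u x) (i j : Fin n) :
    pd2 u i j x = fderiv ℝ (fderiv ℝ u) x (EuclideanSpace.single i 1) (EuclideanSpace.single j 1) := by
  unfold pd2
  rw [fderiv_clm_apply (cd_fderiv hu) (by fun_prop)]
  simp

/-- linear combination -/
lemma Lop_comb (a : EuclideanSpace ℝ (Fin n) → Fin n → Fin n → ℝ)
    (b : EuclideanSpace ℝ (Fin n) → Fin n → ℝ) (c : EuclideanSpace ℝ (Fin n) → ℝ)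
    {u v : EuclideanSpace ℝ (Fin n) → ℝ} {x : EuclideanSpace ℝ (Fin n)}
    (hu : ContDiffAt ℝ 2 u x) (hv : ContDiffAt ℝ 2 v x) (k : ℝ) :
    Lop a b c (fun y => u y - k * v y) x = Lop a b c u x - k * Lop a b c v x := by
  have hkv : ContDiffAt ℝ 2 (fun y => k * v y) x := contDiffAt_const.mul hv
  have hw : ContDiffAt ℝ 2 (fun y => u y - k * v y) x := hu.sub hkv
  have h1 : ∀ᶠ y in 𝓝 x, fderiv ℝ (fun y => u y - k * v y) y = fderiv ℝ u y - k • fderiv ℝ v y := by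
    filter_upwards [cd_ev hu, cd_ev hv] with y h1 h2
    rw [fderiv_fun_sub h1 (h2.const_mul k), fderiv_const_mul h2]
  have h2 : fderiv ℝ (fderiv ℝ (fun y => u y - k * v y)) x
      = fderiv ℝ (fderiv ℝ u) x - k • fderiv ℝ (fderiv ℝ v) x := by
    rw [Filter.EventuallyEq.fderiv_eq h1]
    exact ((cd_fderiv hu).hasFDerivAt.sub ((cd_fderiv hv).hasFDerivAt.const_smul k)).fderiv
  unfold Lop
  simp only [pd2_eq hw, pd2_eq hu, pd2_eq hv, pd, h2, h1.self_of_nhds]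
  simp only [sub_apply, smul_apply, smul_eq_mul, mul_sub,
    Finset.sum_sub_distrib, Finset.mul_sum, Finset.sum_add_distrib, mul_add]
  simp only [mul_left_comm k]
  ring

lemma hess_nonpos {v : EuclideanSpace ℝ (Fin n) → ℝ} {x : EuclideanSpace ℝ (Fin n)}
    (hv : ContDiffAt ℝ 2 v x) (hm : IsLocalMax v x) (e : EuclideanSpace ℝ (Fin n)) :
    fderiv ℝ (fderiv ℝ v) x e e ≤ 0 := by
  set l : ℝ → EuclideanSpace ℝ (Fin n) := fun t => x + t • e with hl
  have hl0 : l 0 = x := by simp [hl]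
  have hlc : Continuous l := by fun_prop
  have hlt : Tendsto l (𝓝 0) (𝓝 x) := by simpa [hl0] using hlc.tendsto 0
  have hld : ∀ t, HasDerivAt l e t := fun t => by
    simpa [hl] using ((hasDerivAt_id t).smul_const e).const_add x
  have hd : ∀ᶠ t in 𝓝 (0:ℝ), deriv (v ∘ l) t = fderiv ℝ v (l t) e := by
    filter_upwards [hlt.eventually (cd_ev hv)] with t ht
    exact (ht.hasFDerivAt.comp_hasDerivAt t (hld t)).deriv
  have hd2 : deriv (deriv (v ∘ l)) 0 = fderiv ℝ (fderiv ℝ v) x e e := by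
    rw [Filter.EventuallyEq.deriv_eq hd]
    have h := cd_fderiv hv
    rw [← hl0] at h
    have h2 := (h.hasFDerivAt.comp_hasDerivAt 0 (hld 0)).clm_apply (hasDerivAt_const (0:ℝ) e)
    rw [hl0] at h2
    simpa using h2.deriv
  have hmax : IsLocalMax (v ∘ l) 0 := by
    have := hlt.eventually hm
    simpa [IsLocalMax, IsMaxFilter, hl0] using this
  by_contra hcon
  push Not at hcon
  rw [← hd2] at hcon
  have hmin := isLocalMin_of_deriv_deriv_pos hcon hmax.deriv_eq_zero
    (ContinuousAt.comp (by rw [hl0]; exact hv.continuousAt) hlc.continuousAt)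
  have hc : (v ∘ l) =ᶠ[𝓝 0] fun _ => (v ∘ l) 0 := by
    filter_upwards [hmax, hmin] with t h1 h2 using le_antisymm h1 h2
  have h3 : deriv (deriv (v ∘ l)) 0 = 0 := by
    rw [Filter.EventuallyEq.deriv_eq hc.deriv]
    simp
  linarith

lemma Lop_nonpos (a : EuclideanSpace ℝ (Fin n) → Fin n → Fin n → ℝ)
    (b : EuclideanSpace ℝ (Fin n) → Fin n → ℝ) (c : EuclideanSpace ℝ (Fin n) → ℝ)
    {v : EuclideanSpace ℝ (Fin n) → ℝ} {x : EuclideanSpace ℝ (Fin n)}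
    (hs : ∀ i j, a x i j = a x j i) (hc : 0 ≤ c x)
    (he : ∀ ξ : EuclideanSpace ℝ (Fin n), 0 ≤ ∑ i, ∑ j, a x i j * ξ i * ξ j)
    (hv : ContDiffAt ℝ 2 v x) (hm : IsLocalMax v x) (h0 : 0 ≤ v x) :
    Lop a b c v x ≤ 0 := by
  have hA : (Matrix.of (a x)).PosSemidef := by
    refine Matrix.PosSemidef.of_dotProduct_mulVec_nonneg ?_ ?_
    · ext i j; simp [hs i j]
    · intro y
      have := he (WithLp.toLp 2 y)
      simp only [dotProduct, Matrix.mulVec, Finset.mul_sum, Matrix.of_apply]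
      refine this.trans (le_of_eq ?_)
      refine Finset.sum_congr rfl fun i _ => Finset.sum_congr rfl fun j _ => ?_
      simp; ring
  obtain ⟨m, w, hw⟩ := Matrix.posSemidef_iff_eq_sum_vecMulVec.1 hA
  have ha : ∀ i j, a x i j = ∑ k, w k i * w k j := by
    intro i j
    have := congrFun (congrFun hw i) j
    simpa [Matrix.sum_apply, Matrix.vecMulVec_apply] using this
  have h1 : ∑ i, ∑ j, a x i j * pd2 v i j x =
      ∑ k, fderiv ℝ (fderiv ℝ v) x (WithLp.toLp 2 (w k)) (WithLp.toLp 2 (w k)) := by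
    have hk : ∀ k, (WithLp.toLp 2 (w k) : EuclideanSpace ℝ (Fin n)) =
        ∑ i, w k i • EuclideanSpace.single i (1:ℝ) := by
      intro k; ext j; simp [Finset.sum_apply, Pi.single_apply]
    simp only [hk, map_sum, map_smul, sum_apply, smul_apply,
      smul_eq_mul, ha, pd2_eq hv, Finset.sum_mul, Finset.mul_sum]
    rw [Finset.sum_congr rfl fun i _ => Finset.sum_comm, Finset.sum_comm]
    refine Finset.sum_congr rfl fun k _ => ?_
    rw [Finset.sum_comm]
    refine Finset.sum_congr rfl fun i _ => Finset.sum_congr rfl fun j _ => ?_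
    ring
  unfold Lop
  rw [h1]
  have h2 := Finset.sum_nonpos fun k (_ : k ∈ Finset.univ) => hess_nonpos hv hm (WithLp.toLp 2 (w k))
  have h3 : ∀ i, pd v i x = 0 := fun i => by simp [pd, hm.fderiv_eq_zero]
  simp only [h3, mul_zero, Finset.sum_const_zero, add_zero]
  nlinarith [mul_nonneg hc h0]

lemma Lop_sq (a : EuclideanSpace ℝ (Fin n) → Fin n → Fin n → ℝ)
    (b : EuclideanSpace ℝ (Fin n) → Fin n → ℝ) (c : EuclideanSpace ℝ (Fin n) → ℝ)
    (x₀ x : EuclideanSpace ℝ (Fin n)) :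
    Lop a b c (fun y => ‖y - x₀‖ ^ 2) x =
      2 * ∑ i, a x i i + 2 * ∑ i, b x i * (x i - x₀ i) - c x * ‖x - x₀‖ ^ 2 := by
  have h1 : ∀ y : EuclideanSpace ℝ (Fin n), ∀ j, fderiv ℝ (fun y => ‖y - x₀‖ ^ 2) y (EuclideanSpace.single j 1) = 2 * (y j - x₀ j) := by
    intro y j
    have := ((hasFDerivAt_id y).sub_const x₀).norm_sq.fderiv
    simp only [id] at this
    rw [this]
    simp [EuclideanSpace.inner_single_right]
  have h2 : ∀ i j, pd2 (fun y => ‖y - x₀‖ ^ 2) i j x = if i = j then 2 else 0 := by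
    intro i j
    unfold pd2
    simp only [h1]
    have : HasFDerivAt (fun y : EuclideanSpace ℝ (Fin n) => 2 * (y j - x₀ j))
        ((2:ℝ) • (EuclideanSpace.proj j : EuclideanSpace ℝ (Fin n) →L[ℝ] ℝ)) x :=
      (((EuclideanSpace.proj j : EuclideanSpace ℝ (Fin n) →L[ℝ] ℝ).hasFDerivAt).sub_const _).const_mul 2
    rw [this.fderiv]
    simp [Pi.single_apply, eq_comm]
  unfold Lop
  simp only [h2, pd, h1]
  simp [Finset.mul_sum, mul_comm, mul_assoc, mul_left_comm]

lemma Lop_exp (a : EuclideanSpace ℝ (Fin n) → Fin n → Fin n → ℝ)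
    (b : EuclideanSpace ℝ (Fin n) → Fin n → ℝ) (c : EuclideanSpace ℝ (Fin n) → ℝ)
    (μ : ℝ) (k : Fin n) (x : EuclideanSpace ℝ (Fin n)) :
    Lop a b c (fun y => Real.exp (μ * y k)) x =
      (μ ^ 2 * a x k k + μ * b x k - c x) * Real.exp (μ * x k) := by
  have h0 : ∀ y : EuclideanSpace ℝ (Fin n), HasFDerivAt (fun y : EuclideanSpace ℝ (Fin n) => Real.exp (μ * y k))
      (Real.exp (μ * y k) • μ • (EuclideanSpace.proj k : EuclideanSpace ℝ (Fin n) →L[ℝ] ℝ)) y := fun y =>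
    (((EuclideanSpace.proj k : EuclideanSpace ℝ (Fin n) →L[ℝ] ℝ).hasFDerivAt).const_mul μ).exp
  have h1 : ∀ y : EuclideanSpace ℝ (Fin n), ∀ j, fderiv ℝ (fun y : EuclideanSpace ℝ (Fin n) => Real.exp (μ * y k)) y (EuclideanSpace.single j 1) =
      (if j = k then μ else 0) * Real.exp (μ * y k) := by
    intro y j
    rw [(h0 y).fderiv]
    by_cases h : j = k <;> simp [h, Ne.symm, mul_comm, eq_comm]
  have h2 : ∀ i j, pd2 (fun y => Real.exp (μ * y k)) i j x =
      (if j = k then μ else 0) * ((if i = k then μ else 0) * Real.exp (μ * x k)) := by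
    intro i j
    unfold pd2
    simp only [h1]
    rw [fderiv_const_mul (h0 x).differentiableAt]
    by_cases h : j = k <;> simp [h, h1]
  unfold Lop
  simp only [h2, pd, h1]
  simp [ite_mul, mul_ite]
  ring

lemma growth {a : EuclideanSpace ℝ (Fin n) → Fin n → Fin n → ℝ}
    {b : EuclideanSpace ℝ (Fin n) → Fin n → ℝ} {c : EuclideanSpace ℝ (Fin n) → ℝ}
    {K lam Lam : ℝ} (hco : CoeffsOK a b c K lam Lam)
    {w : EuclideanSpace ℝ (Fin n) → ℝ} {x₀ : EuclideanSpace ℝ (Fin n)} {r R A : ℝ}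
    (hr : 0 < r) (hrR : r ≤ R) (hA : 0 < A)
    (hw : ∀ y ∈ closedBall x₀ r, ContDiffAt ℝ 2 w y) (hw0 : 0 < w x₀)
    (hL : ∀ y ∈ closedBall x₀ r, 0 < w y → A ≤ Lop a b c w y) :
    ∃ y ∈ closedBall x₀ r, w x₀ + A / (2 * (2 * n * Lam + K + R ^ 2)) * r ^ 2 ≤ w y := by
  obtain ⟨-, -, -, hs, hb, hc, hK, hlam, hlL, he⟩ := hco
  have hLam : 0 < Lam := hlam.trans_le hlL
  set C : ℝ := 2 * n * Lam + K + R ^ 2 with hC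
  have hCpos : 0 < C := by positivity
  set κ : ℝ := A / (2 * C) with hκ
  have hκpos : 0 < κ := by positivity
  have hq : ∀ y, ContDiffAt ℝ 2 (fun y : EuclideanSpace ℝ (Fin n) => ‖y - x₀‖ ^ 2) y := fun y =>
    ((contDiff_id.sub contDiff_const).norm_sq ℝ).contDiffAt
  have hv : ∀ y ∈ closedBall x₀ r, ContDiffAt ℝ 2 (fun y => w y - κ * ‖y - x₀‖ ^ 2) y := fun y hy =>
    (hw y hy).sub (contDiffAt_const.mul (hq y))
  obtain ⟨y, hy, hmax⟩ := (isCompact_closedBall x₀ r).exists_isMaxOn ⟨x₀, by simp [hr.le]⟩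
    (fun y hy => (hv y hy).continuousAt.continuousWithinAt :
      ContinuousOn (fun y => w y - κ * ‖y - x₀‖ ^ 2) _)
  have h0 : w x₀ ≤ w y - κ * ‖y - x₀‖ ^ 2 := by
    have := hmax (mem_closedBall_self hr.le)
    simpa using this
  have hwy : 0 < w y := by
    have : 0 ≤ κ * ‖y - x₀‖ ^ 2 := by positivity
    linarith
  have hyr : ‖y - x₀‖ ≤ r := by simpa [dist_eq_norm] using hy
  refine ⟨y, hy, ?_⟩
  rcases hyr.eq_or_lt with h | h
  · rw [h] at h0; linarith
  exfalso
  have hloc : IsLocalMax (fun y => w y - κ * ‖y - x₀‖ ^ 2) y := by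
    refine hmax.isLocalMax ?_
    exact mem_of_superset (isOpen_ball.mem_nhds (by simpa [dist_eq_norm] using h)) ball_subset_closedBall
  have h1 := Lop_nonpos a b c (hs y) (hc y).1
    (fun ξ => le_trans (by positivity) (he y ξ).1) (hv y hy) hloc (hw0.le.trans h0)
  rw [Lop_comb a b c (hw y hy) (hq y), Lop_sq] at h1
  have h2 := hL y hy hwy
  have htr : ∑ i, a y i i ≤ n * Lam := by
    have : ∀ i ∈ Finset.univ, a y i i ≤ Lam := by
      intro i _
      have := (he y (EuclideanSpace.single i 1)).2
      simpa [Pi.single_apply] using this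
    simpa using Finset.sum_le_sum this
  have hbb : 2 * ∑ i, b y i * (y i - x₀ i) ≤ K + R ^ 2 := by
    have h3 : 2 * ∑ i, b y i * (y i - x₀ i) ≤ ∑ i, (b y i) ^ 2 + ∑ i, (y i - x₀ i) ^ 2 := by
      rw [Finset.mul_sum, ← Finset.sum_add_distrib]
      refine Finset.sum_le_sum fun i _ => ?_
      nlinarith [sq_nonneg (b y i - (y i - x₀ i))]
    have h4 : ∑ i, (y i - x₀ i) ^ 2 = ‖y - x₀‖ ^ 2 := by
      rw [EuclideanSpace.norm_sq_eq]; simp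
    have h5 : ‖y - x₀‖ ^ 2 ≤ R ^ 2 := by
      have := norm_nonneg (y - x₀)
      gcongr
      linarith
    linarith [hb y]
  have hcc : 0 ≤ c y * ‖y - x₀‖ ^ 2 := mul_nonneg (hc y).1 (by positivity)
  have h6 : κ * (2 * ∑ i, a y i i + 2 * ∑ i, b y i * (y i - x₀ i) - c y * ‖y - x₀‖ ^ 2) ≤ κ * C := by
    refine mul_le_mul_of_nonneg_left ?_ hκpos.le
    rw [hC]; linarith
  have h7 : κ * C = A / 2 := by rw [hκ]; field_simp
  linarith

lemma kpow_mono {p k₀ k : ℝ} (hp : 1 < p) (h0 : 1 < k₀) (h : k₀ ≤ k) :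
    0 < k₀ ^ p - k₀ ∧ k₀ ^ p - k₀ ≤ k ^ p - k := by
  have e : ∀ t : ℝ, 1 < t → t ^ p = t * t ^ (p - 1) := fun t ht => by
    rw [← Real.rpow_one_add' (by linarith) (by linarith)]; congr 1; ring
  have h1 : 1 < k₀ ^ (p - 1) := Real.one_lt_rpow h0 (by linarith)
  have h2 : k₀ ^ (p - 1) ≤ k ^ (p - 1) := Real.rpow_le_rpow (by linarith) h (by linarith)
  rw [e k₀ h0, e k (by linarith)]
  constructor <;> nlinarith

lemma closedBall_sub_dom {Ω : Set (EuclideanSpace ℝ (Fin n))} (hΩo : IsOpen Ω) {x : EuclideanSpace ℝ (Fin n)}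
    (hx : x ∈ Ω) {r : ℝ} (hr : 0 ≤ r) (h : r < infDist x (frontier Ω)) : closedBall x r ⊆ Ω := by
  have hpre : IsPreconnected (closedBall x r) := (convex_closedBall x r).isPreconnected
  refine hpre.subset_left_of_subset_union hΩo (isClosed_closure.isOpen_compl : IsOpen (closure Ω)ᶜ)
    (disjoint_compl_right.mono_left subset_closure |>.mono_right le_rfl) ?_ ⟨x, by simp [hr], hx⟩
  intro y hy
  by_cases hyΩ : y ∈ Ω
  · exact Or.inl hyΩ
  · refine Or.inr fun hyc => ?_
    have hyf : y ∈ frontier Ω := by rw [hΩo.frontier_eq]; exact ⟨hyc, hyΩ⟩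
    have := infDist_le_dist_of_mem (x := x) hyf
    rw [mem_closedBall, dist_comm] at hy
    linarith

lemma frontier_ne (hn : 2 ≤ n) {Ω : Set (EuclideanSpace ℝ (Fin n))} (hne : Ω.Nonempty)
    (hb : IsBounded Ω) : (frontier Ω).Nonempty := by
  rw [nonempty_frontier_iff]
  refine ⟨hne, ?_⟩
  rintro rfl
  haveI : Nonempty (Fin n) := ⟨⟨0, by omega⟩⟩
  exact NormedSpace.unbounded_univ ℝ _ hb

lemma infDist_pos_of_mem {Ω : Set (EuclideanSpace ℝ (Fin n))} (hΩo : IsOpen Ω)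
    (hf : (frontier Ω).Nonempty) {x : EuclideanSpace ℝ (Fin n)} (hx : x ∈ Ω) :
    0 < infDist x (frontier Ω) := by
  refine (isClosed_frontier.notMem_iff_infDist_pos hf).1 ?_
  rw [hΩo.frontier_eq]
  exact fun h => h.2 hx

/-- Comparison near the boundary. -/
lemma exists_near (hn : 2 ≤ n) {Ω : Set (EuclideanSpace ℝ (Fin n))} (hΩo : IsOpen Ω)
    (hΩb : IsBounded Ω) {a : EuclideanSpace ℝ (Fin n) → Fin n → Fin n → ℝ}
    {b : EuclideanSpace ℝ (Fin n) → Fin n → ℝ} {c : EuclideanSpace ℝ (Fin n) → ℝ}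
    {K lam Lam : ℝ} (hco : CoeffsOK a b c K lam Lam)
    {w : EuclideanSpace ℝ (Fin n) → ℝ} (hw : ∀ y ∈ Ω, ContDiffAt ℝ 2 w y)
    (hL : ∀ y ∈ Ω, 0 < w y → 0 ≤ Lop a b c w y) {z : EuclideanSpace ℝ (Fin n)} (hz : z ∈ Ω)
    (hwz : 0 < w z) {δ : ℝ} (hδ : 0 < δ) :
    ∃ x ∈ Ω, infDist x (frontier Ω) < δ ∧ 0 < w x := by
  by_contra hcon
  push Not at hcon
  obtain ⟨-, -, -, hs, hb, hc, hK, hlam, hlL, he⟩ := hco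
  set k : Fin n := ⟨0, by omega⟩
  set μ : ℝ := (2 * K + 2) / lam + 1 with hμ
  have hμ1 : 1 ≤ μ := by
    have : 0 ≤ (2 * K + 2) / lam := by positivity
    linarith
  have hμl : μ * lam = 2 * K + 2 + lam := by rw [hμ]; field_simp
  have hexp : ∀ y, 0 < Lop a b c (fun y => Real.exp (μ * y k)) y := by
    intro y
    rw [Lop_exp]
    refine mul_pos ?_ (Real.exp_pos _)
    have h1 : lam ≤ a y k k := by
      have := (he y (EuclideanSpace.single k 1)).1
      simpa [Pi.single_apply] using this
    have h2 : (b y k) ^ 2 ≤ K := le_trans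
      (Finset.single_le_sum (f := fun i => (b y i) ^ 2) (fun i _ => sq_nonneg _) (Finset.mem_univ k)) (hb y)
    have h3 : -(K + 1) ≤ b y k := by nlinarith
    have h4 : μ * (μ * lam) ≤ μ ^ 2 * a y k k := by nlinarith [sq_nonneg μ]
    have h5 : μ * (-(K + 1)) ≤ μ * b y k := by gcongr
    rw [hμl] at h4
    nlinarith [(hc y).2]
  have hq : ∀ y, ContDiffAt ℝ 2 (fun y : EuclideanSpace ℝ (Fin n) => Real.exp (μ * y k)) y := fun y =>
    ((contDiff_const.mul (EuclideanSpace.proj k : EuclideanSpace ℝ (Fin n) →L[ℝ] ℝ).contDiff).exp).contDiffAt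
  set S : Set (EuclideanSpace ℝ (Fin n)) := {x | x ∈ closure Ω ∧ δ / 2 ≤ infDist x (frontier Ω)} with hS
  have hSΩ : S ⊆ Ω := by
    intro x hx
    by_contra hxn
    have : x ∈ frontier Ω := by rw [hΩo.frontier_eq]; exact ⟨hx.1, hxn⟩
    have h0 := infDist_zero_of_mem this
    have := hx.2
    linarith
  have hScl : IsClosed S := isClosed_closure.inter
    (isClosed_le continuous_const (continuous_infDist_pt _))
  have hSc : IsCompact S := Metric.isCompact_of_isClosed_isBounded hScl (hΩb.subset hSΩ)
  have hzS : z ∈ S := ⟨subset_closure hz, by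
    by_contra h
    push Not at h
    have := hcon z hz (by linarith)
    linarith⟩
  obtain ⟨e, heS, hemax⟩ := hSc.exists_isMaxOn ⟨z, hzS⟩
    (fun y _ => (hq y).continuousAt.continuousWithinAt : ContinuousOn (fun y => Real.exp (μ * y k)) S)
  set E := Real.exp (μ * e k) with hE
  have hEpos : 0 < E := Real.exp_pos _
  set ε : ℝ := w z / E with hε
  have hεpos : 0 < ε := by positivity
  have hv : ∀ y ∈ Ω, ContDiffAt ℝ 2 (fun y => w y - (-ε) * Real.exp (μ * y k)) y := fun y hy =>
    (hw y hy).sub (contDiffAt_const.mul (hq y))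
  obtain ⟨y, hyS, hmax⟩ := hSc.exists_isMaxOn ⟨z, hzS⟩
    (fun y hy => (hv y (hSΩ hy)).continuousAt.continuousWithinAt :
      ContinuousOn (fun y => w y - (-ε) * Real.exp (μ * y k)) S)
  have hyΩ := hSΩ hyS
  have h1 : w z - (-ε) * Real.exp (μ * z k) ≤ w y - (-ε) * Real.exp (μ * y k) := hmax hzS
  have h2 : Real.exp (μ * y k) ≤ E := hemax hyS
  have h3 : ε * E = w z := by rw [hε]; field_simp
  have h4 : ε * Real.exp (μ * y k) ≤ ε * E := by gcongr
  have h5 : 0 < ε * Real.exp (μ * z k) := by positivity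
  have h6 : 0 < ε * Real.exp (μ * y k) := by positivity
  have hwy : 0 < w y := by linarith
  have hyd : δ ≤ infDist y (frontier Ω) := by
    by_contra h
    push Not at h
    have := hcon y hyΩ h
    linarith
  have hloc : IsLocalMax (fun y => w y - (-ε) * Real.exp (μ * y k)) y := by
    refine hmax.isLocalMax ?_
    have hop : IsOpen (Ω ∩ {x | δ / 2 < infDist x (frontier Ω)}) :=
      hΩo.inter (isOpen_lt continuous_const (continuous_infDist_pt _))
    refine mem_of_superset (hop.mem_nhds ⟨hyΩ, by show δ / 2 < _; linarith⟩) ?_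
    exact fun x hx => ⟨subset_closure hx.1, le_of_lt hx.2⟩
  have h7 := Lop_nonpos a b c (hs y) (hc y).1
    (fun ξ => le_trans (by positivity) (he y ξ).1) (hv y hyΩ) hloc (by linarith)
  rw [Lop_comb a b c (hw y hyΩ) (hq y)] at h7
  have h8 := hL y hyΩ hwy
  have h9 := mul_pos hεpos (hexp y)
  linarith

lemma le_of_rate (hn : 2 ≤ n)
    (Ω : Set (EuclideanSpace ℝ (Fin n)))
    (hΩo : IsOpen Ω) (hΩc : IsConnected Ω) (hΩb : IsBounded Ω)
    (a : EuclideanSpace ℝ (Fin n) → Fin n → Fin n → ℝ)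
    (b : EuclideanSpace ℝ (Fin n) → Fin n → ℝ)
    (c : EuclideanSpace ℝ (Fin n) → ℝ)
    (K lam Lam : ℝ) (hco : CoeffsOK a b c K lam Lam)
    (p : ℝ) (hp : 1 < p)
    (u₁ u₂ : EuclideanSpace ℝ (Fin n) → ℝ)
    (hu₁ : ContDiffOn ℝ 2 u₁ Ω) (hu₂ : ContDiffOn ℝ 2 u₂ Ω)
    (heq₁ : ∀ x ∈ Ω, Lop a b c u₁ x = (max (u₁ x) 0) ^ p)
    (heq₂ : ∀ x ∈ Ω, Lop a b c u₂ x = (max (u₂ x) 0) ^ p)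
    (N₁ N₂ ρ : ℝ) (hN₁ : 0 < N₁) (hN₂ : 0 < N₂) (hρ : 0 < ρ)
    (hrate₁ : ∀ x ∈ Ω, infDist x (frontier Ω) < ρ →
      N₁ / infDist x (frontier Ω) ^ (2 * p / (p - 1)) ≤ (max (u₁ x) 0) ^ p ∧
      (max (u₁ x) 0) ^ p ≤ N₂ / infDist x (frontier Ω) ^ (2 * p / (p - 1)))
    (hrate₂ : ∀ x ∈ Ω, infDist x (frontier Ω) < ρ →
      N₁ / infDist x (frontier Ω) ^ (2 * p / (p - 1)) ≤ (max (u₂ x) 0) ^ p ∧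
      (max (u₂ x) 0) ^ p ≤ N₂ / infDist x (frontier Ω) ^ (2 * p / (p - 1)))
    (z : EuclideanSpace ℝ (Fin n)) (hz : z ∈ Ω) : u₁ z ≤ u₂ z := by
  by_contra hcon
  push Not at hcon
  have hf := frontier_ne hn hΩc.nonempty hΩb
  have hdpos : ∀ x ∈ Ω, 0 < infDist x (frontier Ω) := fun x hx => infDist_pos_of_mem hΩo hf hx
  set d : EuclideanSpace ℝ (Fin n) → ℝ := fun x => infDist x (frontier Ω) with hd
  have hdlip : ∀ x y, d x ≤ d y + dist x y := fun x y => infDist_le_infDist_add_dist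
  set β : ℝ := 2 * p / (p - 1) with hβ
  have hp0 : 0 < p := by linarith
  have hp1 : 0 < p - 1 := by linarith
  have hβpos : 0 < β := by positivity
  have hβp : (2 - β) * p = -β := by rw [hβ]; field_simp; ring
  have c₁ : ∀ y ∈ Ω, ContDiffAt ℝ 2 u₁ y := fun y hy => hu₁.contDiffAt (hΩo.mem_nhds hy)
  have c₂ : ∀ y ∈ Ω, ContDiffAt ℝ 2 u₂ y := fun y hy => hu₂.contDiffAt (hΩo.mem_nhds hy)
  have cw : ∀ k, ∀ y ∈ Ω, ContDiffAt ℝ 2 (fun y => u₁ y - k * u₂ y) y := fun k y hy =>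
    (c₁ y hy).sub (contDiffAt_const.mul (c₂ y hy))
  have Lw : ∀ k, ∀ y ∈ Ω, Lop a b c (fun y => u₁ y - k * u₂ y) y =
      (max (u₁ y) 0) ^ p - k * (max (u₂ y) 0) ^ p := fun k y hy => by
    rw [Lop_comb a b c (c₁ y hy) (c₂ y hy), heq₁ y hy, heq₂ y hy]
  -- positivity of the second solution near the boundary
  have upos : ∀ x ∈ Ω, d x < ρ → 0 < u₂ x := by
    intro x hx hxd
    by_contra h
    push Not at h
    have h1 := (hrate₂ x hx hxd).1
    rw [max_eq_right h, Real.zero_rpow hp0.ne'] at h1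
    have : 0 < N₁ / infDist x (frontier Ω) ^ β := div_pos hN₁ (Real.rpow_pos_of_pos (hdpos x hx) _)
    linarith
  -- pointwise inequality for `L (u₁ - k u₂)`
  have Lge : ∀ k, 1 < k → ∀ y ∈ Ω, 0 < u₁ y - k * u₂ y →
      (k ^ p - k) * (max (u₂ y) 0) ^ p ≤ Lop a b c (fun y => u₁ y - k * u₂ y) y := by
    intro k hk y hy hpos
    rw [Lw k y hy, sub_mul]
    have h1 : k * max (u₂ y) 0 ≤ max (u₁ y) 0 := by
      rw [mul_max_of_nonneg _ _ (by linarith : (0:ℝ) ≤ k), mul_zero]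
      exact max_le_max (by linarith) le_rfl
    have h2 : (k * max (u₂ y) 0) ^ p ≤ (max (u₁ y) 0) ^ p :=
      Real.rpow_le_rpow (mul_nonneg (by linarith) (le_max_right _ _)) h1 hp0.le
    rw [Real.mul_rpow (by linarith) (le_max_right _ _)] at h2
    linarith
  obtain ⟨k₀, hk₀, hzk⟩ : ∃ k₀ : ℝ, 1 < k₀ ∧ 0 < u₁ z - k₀ * u₂ z := by
    rcases le_or_gt (u₂ z) 0 with h | h
    · exact ⟨2, by norm_num, by linarith⟩
    · refine ⟨(1 + u₁ z / u₂ z) / 2, ?_, ?_⟩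
      · have : 1 < u₁ z / u₂ z := by rwa [one_lt_div h]
        linarith
      · have : (1 + u₁ z / u₂ z) / 2 * u₂ z = (u₂ z + u₁ z) / 2 := by field_simp
        linarith
  obtain ⟨hk₀p, -⟩ := kpow_mono hp hk₀ le_rfl
  have hLam : 0 < Lam := by
    obtain ⟨-, -, -, -, -, -, -, hlam, hlL, -⟩ := hco
    linarith
  have hK : 0 < K := hco.2.2.2.2.2.2.1
  set C : ℝ := 2 * n * Lam + K + ρ ^ 2 with hC
  have hCpos : 0 < C := by positivity
  set σ : ℝ := (k₀ ^ p - k₀) * (N₁ / 3 ^ β) / (2 * C) / N₂ ^ (1 / p) with hσ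
  have hσpos : 0 < σ := by positivity
  set Q : ℝ := (N₂ / N₁) ^ (1 / p) with hQ
  -- the iteration
  have iter : ∀ j : ℕ, ∀ k, k₀ ≤ k → ∀ x ∈ Ω, d x < ρ / 2 ^ j → 0 < u₁ x - k * u₂ x →
      k + j * σ < Q := by
    intro j
    induction j with
    | zero =>
      intro k hk x hx hxd hpos
      have hxρ : d x < ρ := by simpa using hxd
      have h2 := upos x hx hxρ
      have h1 : 0 < u₁ x := by nlinarith
      have r1 := (hrate₁ x hx hxρ).2
      have r2 := (hrate₂ x hx hxρ).1
      rw [max_eq_left h1.le] at r1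
      rw [max_eq_left h2.le] at r2
      have hD : 0 < infDist x (frontier Ω) ^ β := Real.rpow_pos_of_pos (hdpos x hx) _
      have h3 : u₁ x ^ p ≤ (Q * u₂ x) ^ p := by
        rw [Real.mul_rpow (by positivity) h2.le, hQ, ← Real.rpow_mul (by positivity),
          one_div_mul_cancel hp0.ne', Real.rpow_one]
        calc u₁ x ^ p ≤ N₂ / infDist x (frontier Ω) ^ β := r1
          _ = N₂ / N₁ * (N₁ / infDist x (frontier Ω) ^ β) := by field_simp
          _ ≤ N₂ / N₁ * u₂ x ^ p := by gcongr
      have h4 : u₁ x ≤ Q * u₂ x := (Real.rpow_le_rpow_iff h1.le (by positivity) hp0).1 h3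
      have h5 : k * u₂ x < Q * u₂ x := by linarith
      simpa using lt_of_mul_lt_mul_right h5 h2.le
    | succ j ih =>
      intro k hk x hx hxd hpos
      have hdx : 0 < d x := hdpos x hx
      have h2j : (1:ℝ) ≤ 2 ^ j := one_le_pow₀ (by norm_num)
      have hxd' : 2 * d x < ρ / 2 ^ j := by
        rw [pow_succ, ← div_div, lt_div_iff₀ (by norm_num)] at hxd
        linarith
      have hxρ : 2 * d x < ρ := hxd'.trans_le (div_le_self hρ.le h2j)
      set r : ℝ := d x / 2 with hr
      have hrpos : 0 < r := by positivity
      have hball : closedBall x r ⊆ Ω := closedBall_sub_dom hΩo hx hrpos.le (by show r < d x; linarith)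
      have hyd : ∀ y ∈ closedBall x r, r ≤ d y ∧ d y ≤ 3 * r := by
        intro y hy
        rw [mem_closedBall] at hy
        have h1 := hdlip x y
        have h2 := hdlip y x
        rw [dist_comm] at h1
        constructor <;> linarith
      set A : ℝ := (k₀ ^ p - k₀) * (N₁ / (3 * r) ^ β) with hA
      have hApos : 0 < A := by positivity
      have hk1 : 1 < k := by linarith
      obtain ⟨y, hy, hgr⟩ := growth hco (w := fun y => u₁ y - k * u₂ y) (x₀ := x) (r := r) (R := ρ)
        (A := A) hrpos (by linarith) hApos (fun y hy => cw k y (hball hy)) hpos (by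
          intro y hy hwy
          refine le_trans ?_ (Lge k hk1 y (hball hy) hwy)
          obtain ⟨-, hkk⟩ := kpow_mono hp hk₀ hk
          have hdy := hyd y hy
          have hr2 := (hrate₂ y (hball hy) (by show d y < ρ; linarith)).1
          have hdyp : 0 < d y := hdpos y (hball hy)
          have h3 : N₁ / (3 * r) ^ β ≤ N₁ / infDist y (frontier Ω) ^ β := by
            have h4 : infDist y (frontier Ω) ^ β ≤ (3 * r) ^ β :=
              Real.rpow_le_rpow hdyp.le hdy.2 hβpos.le
            have h5 : 0 < infDist y (frontier Ω) ^ β := Real.rpow_pos_of_pos hdyp _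
            gcongr
          rw [hA]
          exact mul_le_mul hkk (h3.trans hr2) (by positivity) (by linarith))
      have hyΩ := hball hy
      have hdy := hyd y hy
      have hyρ : d y < ρ := by linarith
      have hu2 := upos y hyΩ hyρ
      have hup : u₂ y ≤ N₂ ^ (1 / p) * r ^ (2 - β) := by
        refine (Real.rpow_le_rpow_iff hu2.le (by positivity) hp0).1 ?_
        rw [Real.mul_rpow (by positivity) (by positivity), ← Real.rpow_mul hN₂.le,
          one_div_mul_cancel hp0.ne', Real.rpow_one, ← Real.rpow_mul hrpos.le, hβp,
          Real.rpow_neg hrpos.le, ← div_eq_mul_inv]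
        have h3 := (hrate₂ y hyΩ hyρ).2
        rw [max_eq_left hu2.le] at h3
        refine h3.trans ?_
        have h4 : r ^ β ≤ infDist y (frontier Ω) ^ β := Real.rpow_le_rpow hrpos.le hdy.1 hβpos.le
        gcongr
      have hσu : σ * u₂ y ≤ A / (2 * C) * r ^ 2 := by
        refine (mul_le_mul_of_nonneg_left hup hσpos.le).trans (le_of_eq ?_)
        rw [hσ, hA, Real.mul_rpow (by norm_num) hrpos.le, Real.rpow_sub hrpos, Real.rpow_two]
        have : 0 < N₂ ^ (1 / p) := by positivity
        have : 0 < r ^ β := by positivity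
        have : (0:ℝ) < 3 ^ β := by positivity
        field_simp
      have hnew : 0 < u₁ y - (k + σ) * u₂ y := by
        have : u₁ x - k * u₂ x + A / (2 * C) * r ^ 2 ≤ u₁ y - k * u₂ y := hgr
        have e : (k + σ) * u₂ y = k * u₂ y + σ * u₂ y := by ring
        linarith
      have := ih (k + σ) (by linarith) y hyΩ (by linarith) hnew
      push_cast
      linarith
  obtain ⟨j, hj⟩ := exists_nat_gt (Q / σ)
  obtain ⟨x, hx, hxd, hxpos⟩ := exists_near hn hΩo hΩb hco (cw k₀) (fun y hy hwy =>
    le_trans (mul_nonneg hk₀p.le (Real.rpow_nonneg (le_max_right _ _) _)) (Lge k₀ hk₀ y hy hwy)) hz hzk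
    (δ := ρ / 2 ^ j) (by positivity)
  have h1 := iter j k₀ le_rfl x hx hxd hxpos
  rw [div_lt_iff₀ hσpos] at hj
  linarith

end helpers

/-- Theorem 4.1 of the paper, power case. If `u₁, u₂` are blow-up
solutions of `Lu = u₊^p` (`p > 1`, `β = 2p/(p-1)`) both satisfying the two-sided
bound `N₁ d^{-β} ≤ u₊^p ≤ N₂ d^{-β}` in `Δ_ρ = {x ∈ Ω : d(x) < ρ}`, then
`u₁ ≡ u₂` in `Ω`. -/
theorem uniqueness_two_sided_rate_power {n : ℕ} (hn : 2 ≤ n)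
    (Ω : Set (EuclideanSpace ℝ (Fin n)))
    (hΩo : IsOpen Ω) (hΩc : IsConnected Ω) (hΩb : IsBounded Ω)
    (a : EuclideanSpace ℝ (Fin n) → Fin n → Fin n → ℝ)
    (b : EuclideanSpace ℝ (Fin n) → Fin n → ℝ)
    (c : EuclideanSpace ℝ (Fin n) → ℝ)
    (K lam Lam : ℝ) (hco : CoeffsOK a b c K lam Lam)
    (p : ℝ) (hp : 1 < p)
    (u₁ u₂ : EuclideanSpace ℝ (Fin n) → ℝ)
    (hu₁ : ContDiffOn ℝ 2 u₁ Ω) (hu₂ : ContDiffOn ℝ 2 u₂ Ω)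
    (heq₁ : ∀ x ∈ Ω, Lop a b c u₁ x = (max (u₁ x) 0) ^ p)
    (heq₂ : ∀ x ∈ Ω, Lop a b c u₂ x = (max (u₂ x) 0) ^ p)
    (hb₁ : BlowsUp Ω u₁) (hb₂ : BlowsUp Ω u₂)
    (N₁ N₂ ρ : ℝ) (hN₁ : 0 < N₁) (hN₂ : 0 < N₂) (hρ : 0 < ρ)
    (hrate₁ : ∀ x ∈ Ω, infDist x (frontier Ω) < ρ →
      N₁ / infDist x (frontier Ω) ^ (2 * p / (p - 1)) ≤ (max (u₁ x) 0) ^ p ∧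
      (max (u₁ x) 0) ^ p ≤ N₂ / infDist x (frontier Ω) ^ (2 * p / (p - 1)))
    (hrate₂ : ∀ x ∈ Ω, infDist x (frontier Ω) < ρ →
      N₁ / infDist x (frontier Ω) ^ (2 * p / (p - 1)) ≤ (max (u₂ x) 0) ^ p ∧
      (max (u₂ x) 0) ^ p ≤ N₂ / infDist x (frontier Ω) ^ (2 * p / (p - 1))) :
    EqOn u₁ u₂ Ω := by
  intro x hx
  exact le_antisymm
    (le_of_rate hn Ω hΩo hΩc hΩb a b c K lam Lam hco p hp u₁ u₂ hu₁ hu₂ heq₁ heq₂ N₁ N₂ ρ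
      hN₁ hN₂ hρ hrate₁ hrate₂ x hx)
    (le_of_rate hn Ω hΩo hΩc hΩb a b c K lam Lam hco p hp u₂ u₁ hu₂ hu₁ heq₂ heq₁ N₁ N₂ ρ
      hN₁ hN₂ hρ hrate₂ hrate₁ x hx)
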